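/- For every even integer n ≥ 6, the corona product graph C_n⊙K_1 satisfies dim(C_n⊙K_1) = 3 and edim(C_n⊙K_1) = 2; in particular dim(C_n⊙K_1) − edim(C_n⊙K_1) = 1. -/

import Mathlib

open SimpleGraph

variable {V : Type*}

/-- Distance from a vertex `s` to an edge `e`: the minimum of the distances to its endpoints. -/
noncomputable def edgeDist (G : SimpleGraph V) (s : V) (e : Sym2 V) : ℕ :=
  Sym2.lift ⟨fun u w => min (G.dist s u) (G.dist s w), fun u w => min_comm _ _⟩ e

/-- `S` is a vertex metric generator of `G`. -/
def IsVertexMG (G : SimpleGraph V) (S : Set V) : Prop :=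
  ∀ u v : V, u ≠ v → ∃ s ∈ S, G.dist s u ≠ G.dist s v

/-- `S` is an edge metric generator of `G`. -/
def IsEdgeMG (G : SimpleGraph V) (S : Set V) : Prop :=
  ∀ e ∈ G.edgeSet, ∀ f ∈ G.edgeSet, e ≠ f → ∃ s ∈ S, edgeDist G s e ≠ edgeDist G s f

/-- The vertex metric dimension of `G`. -/
noncomputable def metricDim (G : SimpleGraph V) : ℕ :=
  sInf {n | ∃ S : Finset V, S.card = n ∧ IsVertexMG G ↑S}

/-- The edge metric dimension of `G`. -/
noncomputable def edgeMetricDim (G : SimpleGraph V) : ℕ :=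
  sInf {n | ∃ S : Finset V, S.card = n ∧ IsEdgeMG G ↑S}

/-- The corona product `C_n ⊙ K_1`: the cycle on `ZMod n` (the `inl` vertices) together
with one pendant leaf (`inr i`) attached to each cycle vertex (`inl i`). -/
def coronaCycleK1 (n : ℕ) : SimpleGraph (ZMod n ⊕ ZMod n) :=
  SimpleGraph.fromRel (fun x y =>
    (∃ i : ZMod n, x = Sum.inl i ∧ y = Sum.inl (i + 1)) ∨
    (∃ i : ZMod n, x = Sum.inl i ∧ y = Sum.inr i))

section MetricDimension

variable {W : Type*} {G : SimpleGraph W}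

lemma le_add_length_of_lipschitz (f : W → ℕ) (hf : ∀ u v, G.Adj u v → f v ≤ f u + 1)
    {u v : W} (w : G.Walk u v) : f v ≤ f u + w.length := by
  induction w with
  | nil => simp
  | cons h w ih =>
    have := hf _ _ h
    rw [Walk.length_cons]
    omega

lemma dist_eq_of_lipschitz (f : W → ℕ) (hf : ∀ u v, G.Adj u v → f v ≤ f u + 1)
    {s u : W} (hs : f s = 0) (hw : ∃ w : G.Walk s u, w.length ≤ f u) : G.dist s u = f u := by
  obtain ⟨w, hw⟩ := hw
  obtain ⟨w', hw'⟩ := (Walk.reachable w).exists_walk_length_eq_dist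
  have h₁ := le_add_length_of_lipschitz f hf w'
  have h₂ := dist_le w
  omega

@[simp]
lemma edgeDist_mk (s u v : W) : edgeDist G s s(u, v) = min (G.dist s u) (G.dist s v) := rfl

lemma metricDim_eq_three {S : Finset W} (hS : S.card = 3) (hG : IsVertexMG G S)
    (h : ∀ s t : W, ∃ u v, u ≠ v ∧ G.dist s u = G.dist s v ∧ G.dist t u = G.dist t v) :
    metricDim G = 3 := by
  refine le_antisymm (Nat.sInf_le ⟨S, hS, hG⟩) (le_csInf ⟨3, S, hS, hG⟩ ?_)
  rintro _ ⟨T, rfl, hT⟩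
  by_contra! hlt
  have hST : ∃ s t : W, ∀ x ∈ T, x = s ∨ x = t := by
    obtain ⟨a, -⟩ := Finset.card_pos.mp (by omega : 0 < S.card)
    rcases (by omega : T.card = 0 ∨ T.card = 1 ∨ T.card = 2) with h0 | h1 | h2
    · exact ⟨a, a, by simp [Finset.card_eq_zero.mp h0]⟩
    · obtain ⟨b, rfl⟩ := Finset.card_eq_one.mp h1
      exact ⟨b, b, by simp⟩
    · classical
      obtain ⟨b, c, -, rfl⟩ := Finset.card_eq_two.mp h2
      exact ⟨b, c, by simp⟩
  obtain ⟨s, t, hst⟩ := hST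
  obtain ⟨u, v, huv, h₁, h₂⟩ := h s t
  obtain ⟨x, hx, hne⟩ := hT u v huv
  rcases hst x hx with rfl | rfl
  · exact hne h₁
  · exact hne h₂

lemma edgeMetricDim_eq_two {S : Finset W} (hS : S.card = 2) (hG : IsEdgeMG G S)
    (h : ∀ s : W, ∃ e ∈ G.edgeSet, ∃ f ∈ G.edgeSet, e ≠ f ∧ edgeDist G s e = edgeDist G s f) :
    edgeMetricDim G = 2 := by
  refine le_antisymm (Nat.sInf_le ⟨S, hS, hG⟩) (le_csInf ⟨2, S, hS, hG⟩ ?_)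
  rintro _ ⟨T, rfl, hT⟩
  by_contra! hlt
  have hs : ∃ s : W, ∀ x ∈ T, x = s := by
    obtain ⟨a, -⟩ := Finset.card_pos.mp (by omega : 0 < S.card)
    rcases (by omega : T.card = 0 ∨ T.card = 1) with h0 | h1
    · exact ⟨a, by simp [Finset.card_eq_zero.mp h0]⟩
    · obtain ⟨b, rfl⟩ := Finset.card_eq_one.mp h1
      exact ⟨b, by simp⟩
  obtain ⟨s, hs⟩ := hs
  obtain ⟨e, he, f, hf, hef, h₁⟩ := h s
  obtain ⟨x, hx, hne⟩ := hT e he f hf hef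
  rw [hs x hx] at hne
  exact hne h₁

end MetricDimension

namespace coronaCycleK1

variable {n : ℕ}

lemma add_natCast_inj (p : ZMod n) {a b : ℕ} (ha : a < n) (hb : b < n) :
    p + (a : ZMod n) = p + (b : ZMod n) ↔ a = b := by
  rw [add_right_inj]
  refine ⟨fun h => ?_, fun h => by rw [h]⟩
  rw [← ZMod.val_natCast_of_lt ha, ← ZMod.val_natCast_of_lt hb, h]

lemma exists_add_natCast [NeZero n] (p x : ZMod n) : ∃ c < n, x = p + (c : ZMod n) :=
  ⟨(x - p).val, ZMod.val_lt _, by simp⟩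

/-- The distance between two positions on the cycle. -/
def cycleDist (i j : ZMod n) : ℕ := min (i - j).val (j - i).val

lemma cycleDist_comm (i j : ZMod n) : cycleDist i j = cycleDist j i := min_comm _ _

lemma cycleDist_add_natCast [NeZero n] (p : ZMod n) {a b : ℕ} (ha : a < n) (hb : b < n) :
    cycleDist (p + (a : ZMod n)) (p + (b : ZMod n)) =
      min ((a - b) + (b - a)) (n - ((a - b) + (b - a))) := by
  wlog hab : a ≤ b generalizing a b
  · rw [cycleDist_comm, this hb ha (by omega)]
    omega
  have h₁ : p + (b : ZMod n) - (p + (a : ZMod n)) = ((b - a : ℕ) : ZMod n) := by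
    rw [Nat.cast_sub hab]; ring
  have h₂ : p + (a : ZMod n) - (p + (b : ZMod n)) = -((b - a : ℕ) : ZMod n) := by
    rw [← h₁]; ring
  have h₃ : ((b - a : ℕ) : ZMod n).val = b - a := ZMod.val_natCast_of_lt (by omega)
  have h₄ : ((b - a : ℕ) : ZMod n) = 0 ↔ b - a = 0 := by
    rw [← ZMod.val_eq_zero, h₃]
  rw [cycleDist, h₁, h₂, ZMod.neg_val, h₃]
  simp only [h₄]
  split_ifs <;> omega

lemma cycleDist_self (i : ZMod n) : cycleDist i i = 0 := by
  simp [cycleDist]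

lemma cycleDist_succ [NeZero n] (i j : ZMod n) :
    cycleDist i (j + 1) ≤ cycleDist i j + 1 ∧ cycleDist i j ≤ cycleDist i (j + 1) + 1 := by
  obtain ⟨c, hc, rfl⟩ := exists_add_natCast i j
  have hn := NeZero.pos n
  have h₀ := cycleDist_add_natCast i hn hc
  rw [Nat.cast_zero, add_zero] at h₀
  by_cases h : c + 1 < n
  · have h₁ := cycleDist_add_natCast i hn h
    rw [Nat.cast_zero, add_zero, Nat.cast_succ, ← add_assoc] at h₁
    omega
  · have h₁ : i + (c : ZMod n) + 1 = i := by
      rw [add_assoc, ← Nat.cast_succ, (by omega : c.succ = n), ZMod.natCast_self, add_zero]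
    rw [h₁, cycleDist_self]
    omega

lemma adj_iff (x y : ZMod n ⊕ ZMod n) (hn : 1 < n) : (coronaCycleK1 n).Adj x y ↔
    (∃ i, x = .inl i ∧ y = .inl (i + 1)) ∨ (∃ i, x = .inl i ∧ y = .inr i) ∨
    (∃ i, y = .inl i ∧ x = .inl (i + 1)) ∨ (∃ i, y = .inl i ∧ x = .inr i) := by
  have : Fact (1 < n) := ⟨hn⟩
  rw [coronaCycleK1, fromRel_adj]
  constructor
  · exact fun h => or_assoc.mp h.2
  · intro h
    refine ⟨?_, or_assoc.mpr h⟩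
    rcases h with ⟨i, rfl, rfl⟩ | ⟨i, rfl, rfl⟩ | ⟨i, rfl, rfl⟩ | ⟨i, rfl, rfl⟩ <;> simp

/-- The distance function of the corona of a cycle, in closed form. -/
def coronaDist : ZMod n ⊕ ZMod n → ZMod n ⊕ ZMod n → ℕ
  | .inl i, .inl j => cycleDist i j
  | .inl i, .inr j => cycleDist i j + 1
  | .inr i, .inl j => cycleDist i j + 1
  | .inr i, .inr j => if i = j then 0 else cycleDist i j + 2

lemma coronaDist_le_of_adj (hn : 1 < n) (s u v : ZMod n ⊕ ZMod n)
    (h : (coronaCycleK1 n).Adj u v) : coronaDist s v ≤ coronaDist s u + 1 := by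
  have : NeZero n := ⟨by omega⟩
  rw [adj_iff _ _ hn] at h
  rcases s with s | s <;>
  rcases h with ⟨i, rfl, rfl⟩ | ⟨i, rfl, rfl⟩ | ⟨i, rfl, rfl⟩ | ⟨i, rfl, rfl⟩ <;>
  have := cycleDist_succ s i <;> simp only [coronaDist] <;> try omega
  all_goals split_ifs with h
  all_goals first | (subst h; simp only [cycleDist_self]; omega) | omega

lemma exists_walk_add (hn : 1 < n) (i : ZMod n) (c : ℕ) :
    ∃ w : (coronaCycleK1 n).Walk (.inl i) (.inl (i + (c : ZMod n))), w.length = c := by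
  induction c with
  | zero => exact ⟨Walk.nil.copy rfl (by simp), by simp⟩
  | succ c ih =>
    obtain ⟨w, hw⟩ := ih
    have h : (coronaCycleK1 n).Adj (.inl (i + (c : ZMod n))) (.inl (i + ((c + 1 : ℕ) : ZMod n))) :=
      (adj_iff _ _ hn).mpr (.inl ⟨_, rfl, by rw [Nat.cast_succ, add_assoc]⟩)
    exact ⟨w.concat h, by simp [hw]⟩

lemma exists_walk_cycle (hn : 1 < n) (i j : ZMod n) :
    ∃ w : (coronaCycleK1 n).Walk (.inl i) (.inl j), w.length = cycleDist i j := by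
  have : NeZero n := ⟨by omega⟩
  rcases min_choice (i - j).val (j - i).val with h | h
  · obtain ⟨w, hw⟩ := exists_walk_add hn j (i - j).val
    exact ⟨(w.copy rfl (by simp)).reverse, by simp [hw, cycleDist, h]⟩
  · obtain ⟨w, hw⟩ := exists_walk_add hn i (j - i).val
    exact ⟨w.copy rfl (by simp), by simp [hw, cycleDist, h]⟩

lemma adj_leaf (hn : 1 < n) (i : ZMod n) : (coronaCycleK1 n).Adj (.inl i) (.inr i) :=
  (adj_iff _ _ hn).mpr (.inr (.inl ⟨i, rfl, rfl⟩))

lemma adj_succ (hn : 1 < n) (i : ZMod n) : (coronaCycleK1 n).Adj (.inl i) (.inl (i + 1)) :=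
  (adj_iff _ _ hn).mpr (.inl ⟨i, rfl, rfl⟩)

lemma dist_eq (hn : 1 < n) (s u : ZMod n ⊕ ZMod n) :
    (coronaCycleK1 n).dist s u = coronaDist s u := by
  refine dist_eq_of_lipschitz _ (coronaDist_le_of_adj hn s) ?_ ?_
  · rcases s with s | s <;> simp [coronaDist, cycleDist_self]
  · rcases s with i | i <;> rcases u with j | j <;> obtain ⟨w, hw⟩ := exists_walk_cycle hn i j
    · exact ⟨w, hw.le⟩
    · exact ⟨w.concat (adj_leaf hn j), by simp [hw, coronaDist]⟩
    · exact ⟨w.cons (adj_leaf hn i).symm, by simp [hw, coronaDist]⟩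
    · by_cases h : i = j
      · subst h
        exact ⟨Walk.nil, by simp⟩
      · exact ⟨(w.concat (adj_leaf hn j)).cons (adj_leaf hn i).symm,
          by simp [hw, coronaDist, h]⟩

lemma dist_inl_inl (hn : 1 < n) (p : ZMod n) {a b : ℕ} (ha : a < n) (hb : b < n) :
    (coronaCycleK1 n).dist (.inl (p + (a : ZMod n))) (.inl (p + (b : ZMod n))) =
    min ((a - b) + (b - a)) (n - ((a - b) + (b - a))) := by
  have : NeZero n := ⟨by omega⟩
  rw [dist_eq hn, coronaDist, cycleDist_add_natCast p ha hb]

lemma dist_inl_inr (hn : 1 < n) (p : ZMod n) {a b : ℕ} (ha : a < n) (hb : b < n) :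
    (coronaCycleK1 n).dist (.inl (p + (a : ZMod n))) (.inr (p + (b : ZMod n))) =
    min ((a - b) + (b - a)) (n - ((a - b) + (b - a))) + 1 := by
  have : NeZero n := ⟨by omega⟩
  rw [dist_eq hn, coronaDist, cycleDist_add_natCast p ha hb]

lemma dist_inr_inl (hn : 1 < n) (p : ZMod n) {a b : ℕ} (ha : a < n) (hb : b < n) :
    (coronaCycleK1 n).dist (.inr (p + (a : ZMod n))) (.inl (p + (b : ZMod n))) =
    min ((a - b) + (b - a)) (n - ((a - b) + (b - a))) + 1 := by
  have : NeZero n := ⟨by omega⟩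
  rw [dist_eq hn, coronaDist, cycleDist_add_natCast p ha hb]

lemma dist_inr_inr (hn : 1 < n) (p : ZMod n) {a b : ℕ} (ha : a < n) (hb : b < n) :
    (coronaCycleK1 n).dist (.inr (p + (a : ZMod n))) (.inr (p + (b : ZMod n))) =
    if a = b then 0 else min ((a - b) + (b - a)) (n - ((a - b) + (b - a))) + 2 := by
  have : NeZero n := ⟨by omega⟩
  rw [dist_eq hn, coronaDist, cycleDist_add_natCast p ha hb]
  simp only [add_natCast_inj p ha hb]

lemma exists_eq_add_natCast [NeZero n] (p : ZMod n) (u : ZMod n ⊕ ZMod n) :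
    ∃ c < n, u = .inl (p + (c : ZMod n)) ∨ u = .inr (p + (c : ZMod n)) := by
  rcases u with x | x <;> obtain ⟨c, hc, rfl⟩ := exists_add_natCast p x
  · exact ⟨c, hc, .inl rfl⟩
  · exact ⟨c, hc, .inr rfl⟩

lemma exists_not_distinguished_of_le {k d : ℕ} (hk : 3 ≤ k) (hn : n = 2 * k) (hd : d ≤ k)
    (p : ZMod n) {s t : ZMod n ⊕ ZMod n}
    (hs : s = .inl (p + ((0 : ℕ) : ZMod n)) ∨ s = .inr (p + ((0 : ℕ) : ZMod n)))
    (ht : t = .inl (p + (d : ZMod n)) ∨ t = .inr (p + (d : ZMod n))) :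
    ∃ u v, u ≠ v ∧ (coronaCycleK1 n).dist s u = (coronaCycleK1 n).dist s v ∧
      (coronaCycleK1 n).dist t u = (coronaCycleK1 n).dist t v := by
  have h1 : 1 < n := by omega
  by_cases h : d = 0 ∨ d = k
  · refine ⟨.inl (p + ((1 : ℕ) : ZMod n)), .inl (p + ((n - 1 : ℕ) : ZMod n)), ?_⟩
    rcases hs with rfl | rfl <;> rcases ht with rfl | rfl <;>
    simp (disch := omega) only [ne_eq, Sum.inl.injEq, add_natCast_inj p, dist_inl_inl h1 p,
      dist_inr_inl h1 p] <;> omega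
  rcases ht with rfl | rfl
  · refine ⟨.inr (p + (d : ZMod n)), .inl (p + ((d + 1 : ℕ) : ZMod n)), by simp, ?_⟩
    rcases hs with rfl | rfl <;>
    simp (disch := omega) only [dist_inl_inl h1 p, dist_inl_inr h1 p, dist_inr_inl h1 p,
      dist_inr_inr h1 p, if_neg] <;> omega
  rcases hs with rfl | rfl
  · refine ⟨.inr (p + ((0 : ℕ) : ZMod n)), .inl (p + ((n - 1 : ℕ) : ZMod n)), by simp, ?_⟩
    simp (disch := omega) only [dist_inl_inl h1 p, dist_inl_inr h1 p, dist_inr_inl h1 p,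
      dist_inr_inr h1 p, if_neg]
    omega
  by_cases h' : d + 2 ≤ k
  · refine ⟨.inr (p + ((d + 1 : ℕ) : ZMod n)), .inl (p + ((d + 2 : ℕ) : ZMod n)), by simp, ?_⟩
    simp (disch := omega) only [dist_inr_inl h1 p, dist_inr_inr h1 p, if_neg]
    omega
  · refine ⟨.inr (p + ((1 : ℕ) : ZMod n)), .inl (p + ((n - 2 : ℕ) : ZMod n)), by simp, ?_⟩
    simp (disch := omega) only [dist_inr_inl h1 p, dist_inr_inr h1 p, if_neg]
    omega

lemma exists_not_distinguished {k : ℕ} (hk : 3 ≤ k) (hn : n = 2 * k) (s t : ZMod n ⊕ ZMod n) :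
    ∃ u v, u ≠ v ∧ (coronaCycleK1 n).dist s u = (coronaCycleK1 n).dist s v ∧
      (coronaCycleK1 n).dist t u = (coronaCycleK1 n).dist t v := by
  have : NeZero n := ⟨by omega⟩
  obtain ⟨p, hs⟩ : ∃ p : ZMod n, s = .inl p ∨ s = .inr p := by rcases s with p | p <;> simp
  obtain ⟨d, hd, ht⟩ := exists_eq_add_natCast p t
  by_cases h : d ≤ k
  · exact exists_not_distinguished_of_le hk hn h p (by simpa using hs) ht
  · obtain ⟨u, v, huv, h₁, h₂⟩ := exists_not_distinguished_of_le (d := n - d) hk hn (by omega)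
      (p + (d : ZMod n)) (s := t) (t := s) (by simpa using ht)
      (by simpa [Nat.cast_sub hd.le] using hs)
    exact ⟨u, v, huv, h₂, h₁⟩

lemma dist_landmarks {k a : ℕ} (hk : 3 ≤ k) (hn : n = 2 * k) (ha : a < n) :
    ∃ x y z : ℕ,
      (a ≤ k ∧ x = a ∧ y = (a - 1) + (1 - a) ∧ z + a = k ∨
        k < a ∧ x + a = n ∧ y + a = n + 1 ∧ a = z + k) ∧
      (coronaCycleK1 n).dist (.inl (0 + ((0 : ℕ) : ZMod n))) (.inl (0 + (a : ZMod n))) = x ∧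
      (coronaCycleK1 n).dist (.inl (0 + ((1 : ℕ) : ZMod n))) (.inl (0 + (a : ZMod n))) = y ∧
      (coronaCycleK1 n).dist (.inl (0 + (k : ZMod n))) (.inl (0 + (a : ZMod n))) = z ∧
      (coronaCycleK1 n).dist (.inl (0 + ((0 : ℕ) : ZMod n))) (.inr (0 + (a : ZMod n))) = x + 1 ∧
      (coronaCycleK1 n).dist (.inl (0 + ((1 : ℕ) : ZMod n))) (.inr (0 + (a : ZMod n))) = y + 1 ∧
      (coronaCycleK1 n).dist (.inl (0 + (k : ZMod n))) (.inr (0 + (a : ZMod n))) = z + 1 := by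
  have h1 : 1 < n := by omega
  simp (disch := omega) only [dist_inl_inl h1 0, dist_inl_inr h1 0]
  refine ⟨_, _, _, ?_, rfl, rfl, rfl, rfl, rfl, rfl⟩
  rcases le_or_gt a k with h | h
  · exact .inl ⟨h, by omega, by omega, by omega⟩
  · exact .inr ⟨h, by omega, by omega, by omega⟩

lemma isVertexMG {k : ℕ} (hk : 3 ≤ k) (hn : n = 2 * k) :
    IsVertexMG (coronaCycleK1 n) {.inl (0 + ((0 : ℕ) : ZMod n)), .inl (0 + ((1 : ℕ) : ZMod n)),
      .inl (0 + (k : ZMod n))} := by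
  have : NeZero n := ⟨by omega⟩
  intro u v huv
  by_contra! h
  simp only [Set.mem_insert_iff, Set.mem_singleton_iff, forall_eq_or_imp, forall_eq] at h
  obtain ⟨a, ha, hu⟩ := exists_eq_add_natCast 0 u
  obtain ⟨b, hb, hv⟩ := exists_eq_add_natCast 0 v
  obtain ⟨x, y, z, hxyz, h₁, h₂, h₃, h₄, h₅, h₆⟩ := dist_landmarks hk hn ha
  obtain ⟨x', y', z', hxyz', h₁', h₂', h₃', h₄', h₅', h₆'⟩ := dist_landmarks hk hn hb
  rcases hu with rfl | rfl <;> rcases hv with rfl | rfl <;>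
  simp (disch := omega) only [ne_eq, Sum.inl.injEq, Sum.inr.injEq, add_natCast_inj (0 : ZMod n),
    h₁, h₂, h₃, h₄, h₅, h₆, h₁', h₂', h₃', h₄', h₅', h₆'] at h huv <;>
  omega

lemma exists_of_mem_edgeSet (hn : 1 < n) {e : Sym2 (ZMod n ⊕ ZMod n)}
    (he : e ∈ (coronaCycleK1 n).edgeSet) :
    (∃ c < n, e = s(.inl (0 + (c : ZMod n)), .inr (0 + (c : ZMod n)))) ∨
    (∃ c, c + 1 < n ∧ e = s(.inl (0 + (c : ZMod n)), .inl (0 + ((c + 1 : ℕ) : ZMod n)))) ∨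
    e = s(.inl (0 + ((n - 1 : ℕ) : ZMod n)), .inl (0 + ((0 : ℕ) : ZMod n))) := by
  have : NeZero n := ⟨by omega⟩
  have h : ∃ i : ZMod n, e = s(.inl i, .inr i) ∨ e = s(.inl i, .inl (i + 1)) := by
    induction e with
    | h x y =>
      rw [mem_edgeSet, adj_iff _ _ hn] at he
      rcases he with ⟨i, rfl, rfl⟩ | ⟨i, rfl, rfl⟩ | ⟨i, rfl, rfl⟩ | ⟨i, rfl, rfl⟩
      · exact ⟨i, .inr rfl⟩
      · exact ⟨i, .inl rfl⟩
      · exact ⟨i, .inr Sym2.eq_swap⟩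
      · exact ⟨i, .inl Sym2.eq_swap⟩
  obtain ⟨i, h⟩ := h
  obtain ⟨c, hc, rfl⟩ := exists_add_natCast 0 i
  rcases h with rfl | rfl
  · exact .inl ⟨c, hc, rfl⟩
  · by_cases h : c + 1 < n
    · exact .inr (.inl ⟨c, h, by rw [Nat.cast_succ, add_assoc]⟩)
    · obtain rfl : n = c + 1 := by omega
      refine .inr (.inr ?_)
      rw [add_assoc, ← Nat.cast_succ, Nat.succ_eq_add_one, ZMod.natCast_self, Nat.cast_zero,
        Nat.add_sub_cancel]

lemma edgeDist_pendant {k c : ℕ} (hk : 3 ≤ k) (hn : n = 2 * k) (hc : c < n) :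
    ∃ x y : ℕ,
      (c = 0 ∧ x = 0 ∧ y = k ∨ c + 1 = k ∧ x = k ∧ y = 0 ∨
        0 < c ∧ c + 1 < k ∧ x = c + 1 ∧ y + c = k ∨
        k ≤ c ∧ x + c = n + 1 ∧ y + k = c + 2) ∧
      edgeDist (coronaCycleK1 n) (.inr (0 + ((0 : ℕ) : ZMod n)))
        s(.inl (0 + (c : ZMod n)), .inr (0 + (c : ZMod n))) = x ∧
      edgeDist (coronaCycleK1 n) (.inr (0 + ((k - 1 : ℕ) : ZMod n)))
        s(.inl (0 + (c : ZMod n)), .inr (0 + (c : ZMod n))) = y := by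
  have h1 : 1 < n := by omega
  simp (disch := omega) only [edgeDist_mk, dist_inr_inl h1 0, dist_inr_inr h1 0]
  refine ⟨_, _, ?_, rfl, rfl⟩
  rcases (by omega : c = 0 ∨ c + 1 = k ∨ (0 < c ∧ c + 1 < k) ∨ k ≤ c) with h | h | ⟨h, h'⟩ | h
  · exact .inl ⟨h, by split_ifs <;> omega, by split_ifs <;> omega⟩
  · exact .inr (.inl ⟨h, by split_ifs <;> omega, by split_ifs <;> omega⟩)
  · exact .inr (.inr (.inl ⟨h, h', by split_ifs <;> omega, by split_ifs <;> omega⟩))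
  · exact .inr (.inr (.inr ⟨h, by split_ifs <;> omega, by split_ifs <;> omega⟩))

lemma edgeDist_cycle {k c : ℕ} (hk : 3 ≤ k) (hn : n = 2 * k) (hc : c + 1 < n) :
    ∃ x y : ℕ,
      (c + 1 < k ∧ x = c + 1 ∧ y + c + 1 = k ∨ c + 1 = k ∧ x = k ∧ y = 1 ∨
        k ≤ c ∧ x + c = n ∧ y + k = c + 2) ∧
      edgeDist (coronaCycleK1 n) (.inr (0 + ((0 : ℕ) : ZMod n)))
        s(.inl (0 + (c : ZMod n)), .inl (0 + ((c + 1 : ℕ) : ZMod n))) = x ∧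
      edgeDist (coronaCycleK1 n) (.inr (0 + ((k - 1 : ℕ) : ZMod n)))
        s(.inl (0 + (c : ZMod n)), .inl (0 + ((c + 1 : ℕ) : ZMod n))) = y := by
  have h1 : 1 < n := by omega
  simp (disch := omega) only [edgeDist_mk, dist_inr_inl h1 0]
  refine ⟨_, _, ?_, rfl, rfl⟩
  rcases (by omega : c + 1 < k ∨ c + 1 = k ∨ k ≤ c) with h | h | h
  · exact .inl ⟨h, by omega, by omega⟩
  · exact .inr (.inl ⟨h, by omega, by omega⟩)
  · exact .inr (.inr ⟨h, by omega, by omega⟩)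

lemma edgeDist_closing {k : ℕ} (hk : 3 ≤ k) (hn : n = 2 * k) :
    edgeDist (coronaCycleK1 n) (.inr (0 + ((0 : ℕ) : ZMod n)))
        s(.inl (0 + ((n - 1 : ℕ) : ZMod n)), .inl (0 + ((0 : ℕ) : ZMod n))) = 1 ∧
      edgeDist (coronaCycleK1 n) (.inr (0 + ((k - 1 : ℕ) : ZMod n)))
        s(.inl (0 + ((n - 1 : ℕ) : ZMod n)), .inl (0 + ((0 : ℕ) : ZMod n))) = k := by
  have h1 : 1 < n := by omega
  simp (disch := omega) only [edgeDist_mk, dist_inr_inl h1 0]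
  exact ⟨by omega, by omega⟩

lemma isEdgeMG {k : ℕ} (hk : 3 ≤ k) (hn : n = 2 * k) :
    IsEdgeMG (coronaCycleK1 n)
      {.inr (0 + ((0 : ℕ) : ZMod n)), .inr (0 + ((k - 1 : ℕ) : ZMod n))} := by
  have h1 : 1 < n := by omega
  intro e he f hf hef
  by_contra! h
  simp only [Set.mem_insert_iff, Set.mem_singleton_iff, forall_eq_or_imp, forall_eq] at h
  obtain ⟨h₀, hk₀⟩ := edgeDist_closing hk hn
  rcases exists_of_mem_edgeSet h1 he with ⟨a, ha, rfl⟩ | ⟨a, ha, rfl⟩ | rfl <;>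
  rcases exists_of_mem_edgeSet h1 hf with ⟨b, hb, rfl⟩ | ⟨b, hb, rfl⟩ | rfl
  · have hab : a ≠ b := by rintro rfl; exact hef rfl
    obtain ⟨x, y, hxy, hx, hy⟩ := edgeDist_pendant hk hn ha
    obtain ⟨x', y', hxy', hx', hy'⟩ := edgeDist_pendant hk hn hb
    omega
  · obtain ⟨x, y, hxy, hx, hy⟩ := edgeDist_pendant hk hn ha
    obtain ⟨x', y', hxy', hx', hy'⟩ := edgeDist_cycle hk hn hb
    omega
  · obtain ⟨x, y, hxy, hx, hy⟩ := edgeDist_pendant hk hn ha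
    omega
  · obtain ⟨x, y, hxy, hx, hy⟩ := edgeDist_cycle hk hn ha
    obtain ⟨x', y', hxy', hx', hy'⟩ := edgeDist_pendant hk hn hb
    omega
  · have hab : a ≠ b := by rintro rfl; exact hef rfl
    obtain ⟨x, y, hxy, hx, hy⟩ := edgeDist_cycle hk hn ha
    obtain ⟨x', y', hxy', hx', hy'⟩ := edgeDist_cycle hk hn hb
    omega
  · obtain ⟨x, y, hxy, hx, hy⟩ := edgeDist_cycle hk hn ha
    omega
  · obtain ⟨x, y, hxy, hx, hy⟩ := edgeDist_pendant hk hn hb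
    omega
  · obtain ⟨x, y, hxy, hx, hy⟩ := edgeDist_cycle hk hn hb
    omega
  · exact hef rfl

lemma exists_edges_not_distinguished (hn : 2 < n) (s : ZMod n ⊕ ZMod n) :
    ∃ e ∈ (coronaCycleK1 n).edgeSet, ∃ f ∈ (coronaCycleK1 n).edgeSet, e ≠ f ∧
      edgeDist (coronaCycleK1 n) s e = edgeDist (coronaCycleK1 n) s f := by
  have h1 : 1 < n := by omega
  have : NeZero n := ⟨by omega⟩
  obtain ⟨p, hs⟩ : ∃ p : ZMod n, s = .inl (p + ((0 : ℕ) : ZMod n)) ∨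
      s = .inr (p + ((0 : ℕ) : ZMod n)) := by rcases s with p | p <;> exact ⟨p, by simp⟩
  refine ⟨s(.inl (p + ((0 : ℕ) : ZMod n)), .inl (p + ((1 : ℕ) : ZMod n))), ?_,
    s(.inl (p + ((n - 1 : ℕ) : ZMod n)), .inl (p + ((0 : ℕ) : ZMod n))), ?_, ?_, ?_⟩
  · rw [mem_edgeSet]
    simpa using adj_succ h1 p
  · rw [mem_edgeSet]
    simpa [Nat.cast_sub h1.le] using adj_succ h1 (p + ((n - 1 : ℕ) : ZMod n))
  · simp (disch := omega) only [ne_eq, Sym2.eq_iff, Sum.inl.injEq, add_natCast_inj p]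
    omega
  · rcases hs with rfl | rfl <;>
    simp (disch := omega) only [edgeDist_mk, dist_inl_inl h1 p, dist_inr_inl h1 p] <;> omega

end coronaCycleK1

theorem statement_17 (n : ℕ) (hn : 6 ≤ n) (hpar : Even n) :
    metricDim (coronaCycleK1 n) = 3 ∧ edgeMetricDim (coronaCycleK1 n) = 2 ∧
    (metricDim (coronaCycleK1 n) : ℤ) - edgeMetricDim (coronaCycleK1 n) = 1 := by
  obtain ⟨k, hk⟩ := hpar
  have hk3 : 3 ≤ k := by omega
  have hn2 : n = 2 * k := by omega
  have hv : metricDim (coronaCycleK1 n) = 3 := by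
    refine metricDim_eq_three (S := {.inl (0 + ((0 : ℕ) : ZMod n)),
      .inl (0 + ((1 : ℕ) : ZMod n)), .inl (0 + (k : ZMod n))}) ?_ ?_
      (coronaCycleK1.exists_not_distinguished hk3 hn2)
    · refine Finset.card_eq_three.mpr ⟨_, _, _, ?_, ?_, ?_, rfl⟩ <;>
      simp (disch := omega) only [ne_eq, Sum.inl.injEq,
        coronaCycleK1.add_natCast_inj (0 : ZMod n)] <;> omega
    · simpa using coronaCycleK1.isVertexMG hk3 hn2
  have he : edgeMetricDim (coronaCycleK1 n) = 2 := by
    refine edgeMetricDim_eq_two (S := {.inr (0 + ((0 : ℕ) : ZMod n)),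
      .inr (0 + ((k - 1 : ℕ) : ZMod n))}) ?_ ?_
      (coronaCycleK1.exists_edges_not_distinguished (by omega))
    · refine Finset.card_pair ?_
      simp (disch := omega) only [ne_eq, Sum.inr.injEq,
        coronaCycleK1.add_natCast_inj (0 : ZMod n)]
      omega
    · simpa using coronaCycleK1.isEdgeMG hk3 hn2
  exact ⟨hv, he, by rw [hv, he]; norm_num⟩
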